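/- Let A ⊆ Ω_{κ,n} be a symmetric set (ω ∈ A implies σω ∈ A for every permutation σ ∈ S_n acting by permuting coordinates) with P_{κ,n}(A) ≥ 1/2. Then for every t ≥ 0, P_{κ,n}( d_T(·, A) ≥ t ) ≤ e · exp(− t² / (16 (1 − n/N))). -/

import Mathlib

open Finset Real
open scoped Classical

noncomputable section

/-- The multislice `Ω_κ ⊆ 𝒳^N`: vectors with values in `{x ℓ}` where the value `x ℓ`
appears exactly `κ ℓ` times. -/
def multislice (L N : ℕ) (κ : Fin L → ℕ) (x : Fin L → ℝ) : Finset (Fin N → ℝ) :=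
  (Fintype.piFinset fun _ : Fin N => Finset.image x Finset.univ).filter
    (fun ω => ∀ ℓ : Fin L, (Finset.univ.filter fun i => ω i = x ℓ).card = κ ℓ)

/-- Expectation with respect to the uniform distribution on a finite set. -/
def uexpect {α : Type*} (Ω : Finset α) (f : α → ℝ) : ℝ := (∑ ω ∈ Ω, f ω) / Ω.card

/-- Probability of an event with respect to the uniform distribution on a finite set. -/
def uprob {α : Type*} (Ω : Finset α) (p : α → Prop) : ℝ :=
  ((Ω.filter p).card : ℝ) / Ω.card

/-- `Ω_{κ,n}`: the image of the multislice under the projection onto the first `n`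
coordinates (`n` out of `N` sampling without replacement). -/
def msProj (L N n : ℕ) (κ : Fin L → ℕ) (x : Fin L → ℝ) (hn : n ≤ N) :
    Finset (Fin n → ℝ) :=
  (multislice L N κ x).image (fun ω => fun i : Fin n => ω (Fin.castLE hn i))

/-- Expectation `E_{κ,n}` with respect to `P_{κ,n}`, the push-forward of the uniform
distribution `P_κ` on the multislice under the projection onto the first `n` coordinates. -/
def msExpectN (L N n : ℕ) (κ : Fin L → ℕ) (x : Fin L → ℝ) (hn : n ≤ N)
    (f : (Fin n → ℝ) → ℝ) : ℝ :=
  uexpect (multislice L N κ x) (fun ω => f (fun i : Fin n => ω (Fin.castLE hn i)))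

/-- Probability `P_{κ,n}` of an event, i.e. the push-forward of the uniform distribution
`P_κ` on the multislice under the projection onto the first `n` coordinates. -/
def msProbN (L N n : ℕ) (κ : Fin L → ℕ) (x : Fin L → ℝ) (hn : n ≤ N)
    (p : (Fin n → ℝ) → Prop) : ℝ :=
  uprob (multislice L N κ x) (fun ω => p (fun i : Fin n => ω (Fin.castLE hn i)))

/-- Talagrand's convex distance `d_T(ω, A)` between a point `ω` and a set `A`. -/
def convexDist {m : ℕ} (ω : Fin m → ℝ) (A : Set (Fin m → ℝ)) : ℝ :=
  sSup { r : ℝ | ∃ α : Fin m → ℝ, (∑ i, α i ^ 2) = 1 ∧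
    r = sInf { s : ℝ | ∃ ω' ∈ A, s = ∑ i, |α i| * (if ω i = ω' i then (0 : ℝ) else 1) } }

lemma mul_log_div_ge {u v c : ℝ} (hu : 0 < u) (hv : 0 < v) (hc : 0 < c) :
    u * Real.log c + (u - c * v) ≤ u * (Real.log u - Real.log v) := by
  have h := Real.log_le_sub_one_of_pos (show 0 < c * v / u by positivity)
  rw [Real.log_div (by positivity) hu.ne', Real.log_mul hc.ne' hv.ne'] at h
  have h2 := mul_le_mul_of_nonneg_left h hu.le
  have h3 : u * (c * v / u - 1) = c * v - u := by field_simp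
  rw [h3] at h2
  linarith

/-- The log-sum inequality. -/
lemma log_sum_le {ι : Type*} (s : Finset ι) (hs : s.Nonempty) (u v : ι → ℝ)
    (hu : ∀ i ∈ s, 0 < u i) (hv : ∀ i ∈ s, 0 < v i) :
    (∑ i ∈ s, u i) * (Real.log (∑ i ∈ s, u i) - Real.log (∑ i ∈ s, v i)) ≤
      ∑ i ∈ s, u i * (Real.log (u i) - Real.log (v i)) := by
  have hU : 0 < ∑ i ∈ s, u i := Finset.sum_pos hu hs
  have hV : 0 < ∑ i ∈ s, v i := Finset.sum_pos hv hs
  have h := Finset.sum_le_sum fun i hi => mul_log_div_ge (hu i hi) (hv i hi) (div_pos hU hV)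
  rw [Finset.sum_add_distrib, ← Finset.sum_mul, Finset.sum_sub_distrib, ← Finset.mul_sum,
    div_mul_cancel₀ _ hV.ne', sub_self, add_zero, Real.log_div hU.ne' hV.ne'] at h
  exact h

/-- The symmetrised relative entropy density `(u - v) (log u - log v)`. -/
def logDiff (u v : ℝ) : ℝ := (u - v) * (Real.log u - Real.log v)

lemma logDiff_nonneg {u v : ℝ} (hu : 0 < u) (hv : 0 < v) : 0 ≤ logDiff u v := by
  unfold logDiff
  rcases le_total u v with h | h
  · have := Real.log_le_log hu h
    exact mul_nonneg_of_nonpos_of_nonpos (by linarith) (by linarith)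
  · have := Real.log_le_log hv h
    exact mul_nonneg (by linarith) (by linarith)

lemma logDiff_mul {r u v : ℝ} (hr : 0 < r) (hu : 0 < u) (hv : 0 < v) :
    logDiff (r * u) (r * v) = r * logDiff u v := by
  unfold logDiff
  rw [Real.log_mul hr.ne' hu.ne', Real.log_mul hr.ne' hv.ne']
  ring

lemma logDiff_sum_le {ι : Type*} (s : Finset ι) (hs : s.Nonempty) (u v : ι → ℝ)
    (hu : ∀ i ∈ s, 0 < u i) (hv : ∀ i ∈ s, 0 < v i) :
    logDiff (∑ i ∈ s, u i) (∑ i ∈ s, v i) ≤ ∑ i ∈ s, logDiff (u i) (v i) := by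
  have h1 := log_sum_le s hs u v hu hv
  have h2 := log_sum_le s hs v u hv hu
  have h3 : ∑ i ∈ s, logDiff (u i) (v i) = ∑ i ∈ s, u i * (Real.log (u i) - Real.log (v i)) +
      ∑ i ∈ s, v i * (Real.log (v i) - Real.log (u i)) := by
    rw [← Finset.sum_add_distrib]
    exact Finset.sum_congr rfl fun i _ => by unfold logDiff; ring
  rw [h3]
  unfold logDiff
  linarith

/-- Entropy of a two-point space is bounded by a covariance. -/
lemma two_point_entropy_le {z w m l : ℝ} (hz : 0 < z) (hw : 0 < w) (hm : 0 < m) (hl : 0 < l) :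
    z * Real.log (z / m) + w * Real.log (w / l) - (z + w) * Real.log ((z + w) / (m + l)) ≤
      logDiff (m * w) (l * z) / (m + l) := by
  have hc := strictConcaveOn_log_Ioi.concaveOn.2 (show z / m ∈ Set.Ioi (0 : ℝ) from div_pos hz hm)
    (show w / l ∈ Set.Ioi (0 : ℝ) from div_pos hw hl)
    (show 0 ≤ m / (m + l) by positivity) (show 0 ≤ l / (m + l) by positivity)
    (by field_simp)
  simp only [smul_eq_mul] at hc
  have e : m / (m + l) * (z / m) + l / (m + l) * (w / l) = (z + w) / (m + l) := by field_simp
  rw [e] at hc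
  have e2 : logDiff (m * w) (l * z) / (m + l) =
      (m / (m + l) * w - l / (m + l) * z) * (Real.log (w / l) - Real.log (z / m)) := by
    unfold logDiff
    rw [Real.log_mul hm.ne' hw.ne', Real.log_mul hl.ne' hz.ne', Real.log_div hw.ne' hl.ne',
      Real.log_div hz.ne' hm.ne']
    field_simp
    ring
  rw [e2]
  have h4 : m / (m + l) = 1 - l / (m + l) := by field_simp; ring
  rw [h4] at hc ⊢
  have := mul_le_mul_of_nonneg_left hc (add_pos hz hw).le
  linarith

section Slice

variable {α : Type*} [DecidableEq α]

/-- The unnormalised entropy of `f` on the `n`-element subsets of `U`. -/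
def sliceEntropy (U : Finset α) (n : ℕ) (f : Finset α → ℝ) : ℝ :=
  (∑ S ∈ U.powersetCard n, f S * Real.log (f S)) -
    (∑ S ∈ U.powersetCard n, f S) *
      Real.log ((∑ S ∈ U.powersetCard n, f S) / (U.powersetCard n).card)

/-- Sum of `g S S'` over `n`-element subsets `S` of `U` and the sets `S'` obtained from `S` by
exchanging one element of `S` for an element of `U \ S`. -/
def exchangeSum (U : Finset α) (n : ℕ) (g : Finset α → Finset α → ℝ) : ℝ :=
  ∑ S ∈ U.powersetCard n, ∑ a ∈ S, ∑ b ∈ U \ S, g S (insert b (S.erase a))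

lemma exchangeSum_comm (U : Finset α) (n : ℕ) (g : Finset α → Finset α → ℝ) :
    exchangeSum U n (fun S T => g T S) = exchangeSum U n g := by
  unfold exchangeSum
  simp only [Finset.sum_sigma']
  refine Finset.sum_nbij' (fun p => ⟨insert p.2.2 (p.1.erase p.2.1), p.2.2, p.2.1⟩)
    (fun p => ⟨insert p.2.2 (p.1.erase p.2.1), p.2.2, p.2.1⟩) ?_ ?_ ?_ ?_ ?_
  all_goals
    rintro ⟨S, a, b⟩ h
    simp only [Finset.mem_sigma, Finset.mem_powersetCard, Finset.mem_sdiff] at h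
    obtain ⟨⟨hS, hc⟩, ha, hb, hbS⟩ := h
    have hab : a ≠ b := fun h => hbS (h ▸ ha)
    have hback : insert a ((insert b (S.erase a)).erase b) = S := by
      rw [Finset.erase_insert (by simp [hbS]), Finset.insert_erase ha]
  any_goals
    simp only [Finset.mem_sigma, Finset.mem_powersetCard, Finset.mem_sdiff]
    refine ⟨⟨?_, ?_⟩, by simp, hS ha, by simp [hab]⟩
    · exact Finset.insert_subset hb ((Finset.erase_subset _ _).trans hS)
    · rw [Finset.card_insert_of_notMem (by simp [hbS]), Finset.card_erase_of_mem ha]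
      have := Finset.card_pos.2 ⟨a, ha⟩
      omega
  · simp only [hback]
  · simp only [hback]
  · simp only [hback]

lemma sum_powersetCard_split {k : α} {U : Finset α} (hk : k ∈ U) (n : ℕ) (g : Finset α → ℝ) :
    ∑ S ∈ U.powersetCard (n + 1), g S = ∑ S ∈ (U.erase k).powersetCard (n + 1), g S +
      ∑ T ∈ (U.erase k).powersetCard n, g (insert k T) := by
  conv_lhs => rw [← Finset.insert_erase hk]
  rw [Finset.powersetCard_succ_insert (Finset.notMem_erase k U), Finset.sum_union,
    Finset.sum_image]
  · intro S hS T hT h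
    have h1 : k ∉ S := fun h => by
      simpa using (Finset.mem_powersetCard.1 hS).1 h
    have h2 : k ∉ T := fun h => by
      simpa using (Finset.mem_powersetCard.1 hT).1 h
    rw [← Finset.erase_insert h1, ← Finset.erase_insert h2]
    exact congrArg (fun S => S.erase k) h
  · rw [Finset.disjoint_left]
    intro S hS hS'
    obtain ⟨T, -, rfl⟩ := Finset.mem_image.1 hS'
    simpa using (Finset.mem_powersetCard.1 hS).1 (Finset.mem_insert_self k T)

lemma sum_powersetCard_insert (U : Finset α) (n : ℕ) (h : Finset α → ℝ) :
    ∑ T ∈ U.powersetCard n, ∑ b ∈ U \ T, h (insert b T) =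
      (n + 1) * ∑ S ∈ U.powersetCard (n + 1), h S := by
  have e : (n + 1) * ∑ S ∈ U.powersetCard (n + 1), h S =
      ∑ S ∈ U.powersetCard (n + 1), ∑ b ∈ S, h S := by
    rw [Finset.mul_sum]
    refine Finset.sum_congr rfl fun S hS => ?_
    rw [Finset.sum_const, (Finset.mem_powersetCard.1 hS).2]
    simp
  rw [e]
  simp only [Finset.sum_sigma']
  refine Finset.sum_nbij' (fun p => ⟨insert p.2 p.1, p.2⟩) (fun p => ⟨p.1.erase p.2, p.2⟩)
    ?_ ?_ ?_ ?_ ?_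
  · rintro ⟨T, b⟩ hp
    simp only [Finset.mem_sigma, Finset.mem_powersetCard, Finset.mem_sdiff] at hp ⊢
    exact ⟨⟨Finset.insert_subset hp.2.1 hp.1.1, by
      rw [Finset.card_insert_of_notMem hp.2.2, hp.1.2]⟩, by simp⟩
  · rintro ⟨S, b⟩ hp
    simp only [Finset.mem_sigma, Finset.mem_powersetCard, Finset.mem_sdiff] at hp ⊢
    exact ⟨⟨(Finset.erase_subset _ _).trans hp.1.1, by
      rw [Finset.card_erase_of_mem hp.2, hp.1.2]; rfl⟩, hp.1.1 hp.2, by simp⟩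
  · rintro ⟨T, b⟩ hp
    simp only [Finset.mem_sigma, Finset.mem_sdiff] at hp
    simp [Finset.erase_insert hp.2.2]
  · rintro ⟨S, b⟩ hp
    simp only [Finset.mem_sigma] at hp
    simp [Finset.insert_erase hp.2]
  · simp

lemma sum_sum_erase (s : Finset α) (h : α → ℝ) :
    ∑ k ∈ s, ∑ a ∈ s.erase k, h a = (s.card - 1) * ∑ a ∈ s, h a := by
  have : ∀ k ∈ s, ∑ a ∈ s.erase k, h a = ∑ a ∈ s, h a - h k := fun k hk =>
    eq_sub_of_add_eq (Finset.sum_erase_add s h hk)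
  rw [Finset.sum_congr rfl this, Finset.sum_sub_distrib, Finset.sum_const, nsmul_eq_mul]
  ring

lemma exchangeSum_erase {k : α} (U : Finset α) (n : ℕ) (g : Finset α → Finset α → ℝ) :
    exchangeSum (U.erase k) n g = ∑ S ∈ U.powersetCard n,
      if k ∈ S then 0 else ∑ a ∈ S, ∑ b ∈ (U \ S).erase k, g S (insert b (S.erase a)) := by
  unfold exchangeSum
  rw [← Finset.sum_subset (Finset.powersetCard_mono (Finset.erase_subset k U))]
  · refine Finset.sum_congr rfl fun S hS => ?_
    have h1 : k ∉ S := fun h => by simpa using (Finset.mem_powersetCard.1 hS).1 h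
    rw [if_neg h1, Finset.erase_sdiff_comm]
  · intro S hS hS'
    rw [Finset.mem_powersetCard] at hS hS'
    rw [if_pos]
    by_contra hk
    exact hS' ⟨Finset.subset_erase.2 ⟨hS.1, hk⟩, hS.2⟩

lemma exchangeSum_erase_insert {k : α} {U : Finset α} (hk : k ∈ U) (n : ℕ)
    (g : Finset α → Finset α → ℝ) :
    exchangeSum (U.erase k) n (fun S T => g (insert k S) (insert k T)) =
      ∑ S ∈ U.powersetCard (n + 1),
        if k ∈ S then ∑ a ∈ S.erase k, ∑ b ∈ U \ S, g S (insert b (S.erase a)) else 0 := by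
  rw [sum_powersetCard_split hk]
  rw [Finset.sum_eq_zero (s := (U.erase k).powersetCard (n + 1)), zero_add]
  · unfold exchangeSum
    refine Finset.sum_congr rfl fun S hS => ?_
    have h1 : k ∉ S := fun h => by simpa using (Finset.mem_powersetCard.1 hS).1 h
    rw [if_pos (Finset.mem_insert_self k S), Finset.erase_insert h1]
    refine Finset.sum_congr rfl fun a ha => ?_
    have hak : k ≠ a := fun h => h1 (h ▸ ha)
    have e : U \ insert k S = U.erase k \ S := by
      ext x; simp only [Finset.mem_sdiff, Finset.mem_insert, Finset.mem_erase]; tauto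
    rw [e]
    refine Finset.sum_congr rfl fun b hb => ?_
    rw [Finset.erase_insert_of_ne hak, Finset.insert_comm]
  · intro S hS
    have h1 : k ∉ S := fun h => by simpa using (Finset.mem_powersetCard.1 hS).1 h
    rw [if_neg h1]

/-- Averaging the conditioned exchange sums over the conditioned element. -/
lemma sum_exchangeSum_erase (U : Finset α) (n : ℕ) (g : Finset α → Finset α → ℝ) :
    ∑ k ∈ U, (exchangeSum (U.erase k) (n + 1) g +
      exchangeSum (U.erase k) n (fun S T => g (insert k S) (insert k T))) =
      (U.card - 2) * exchangeSum U (n + 1) g := by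
  have e : ∀ k ∈ U, exchangeSum (U.erase k) (n + 1) g +
      exchangeSum (U.erase k) n (fun S T => g (insert k S) (insert k T)) =
      ∑ S ∈ U.powersetCard (n + 1), if k ∈ S
        then ∑ a ∈ S.erase k, ∑ b ∈ U \ S, g S (insert b (S.erase a))
        else ∑ a ∈ S, ∑ b ∈ (U \ S).erase k, g S (insert b (S.erase a)) := by
    intro k hk
    rw [exchangeSum_erase, exchangeSum_erase_insert hk, ← Finset.sum_add_distrib]
    refine Finset.sum_congr rfl fun S _ => ?_
    split_ifs <;> simp
  rw [Finset.sum_congr rfl e, Finset.sum_comm, exchangeSum, Finset.mul_sum]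
  refine Finset.sum_congr rfl fun S hS => ?_
  have hSU := (Finset.mem_powersetCard.1 hS).1
  rw [← Finset.sum_sdiff hSU,
    Finset.sum_congr rfl (fun k hk => if_neg (Finset.mem_sdiff.1 hk).2),
    Finset.sum_congr (s₁ := S) rfl (fun k hk => if_pos hk), sum_sum_erase, Finset.sum_comm]
  simp only [sum_sum_erase]
  rw [← Finset.mul_sum, ← add_mul, Finset.card_sdiff_of_subset hSU,
    Nat.cast_sub (Finset.card_le_card hSU)]
  ring

end Slice

lemma sliceEntropy_eq_zero {α : Type*} {U : Finset α} {n : ℕ} (h : ∃ S, U.powersetCard n = {S})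
    (f : Finset α → ℝ) : sliceEntropy U n f = 0 := by
  obtain ⟨S, hS⟩ := h
  simp [sliceEntropy, hS]

section SliceEntropy

variable {α : Type*} [DecidableEq α]

lemma exchangeSum_nonneg {U : Finset α} {n : ℕ} {g : Finset α → Finset α → ℝ}
    (hg : ∀ S T, 0 ≤ g S T) : 0 ≤ exchangeSum U n g :=
  Finset.sum_nonneg fun _ _ => Finset.sum_nonneg fun _ _ => Finset.sum_nonneg fun _ _ => hg _ _

/-- The between-blocks part of the entropy when conditioning on whether `k` is selected. -/
lemma sliceEntropy_erase_add_le {k : α} {U : Finset α} (hk : k ∈ U) {n : ℕ} (hn : n + 1 < U.card)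
    {f : Finset α → ℝ} (hf : ∀ S, 0 < f S) :
    sliceEntropy U (n + 1) f ≤ sliceEntropy (U.erase k) (n + 1) f +
      sliceEntropy (U.erase k) n (fun S => f (insert k S)) +
      (∑ S ∈ U.powersetCard (n + 1), if k ∈ S then ∑ b ∈ U \ S,
        logDiff (f S) (f (insert b (S.erase k))) else 0) / U.card := by
  set V := U.erase k with hV
  have hVc : V.card = U.card - 1 := Finset.card_erase_of_mem hk
  set z := ∑ S ∈ V.powersetCard (n + 1), f S with hz
  set w := ∑ S ∈ V.powersetCard n, f (insert k S) with hw
  have hm0 : 0 < (V.powersetCard (n + 1)).card := by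
    rw [Finset.card_powersetCard]; exact Nat.choose_pos (by omega)
  have hl0 : 0 < (V.powersetCard n).card := by
    rw [Finset.card_powersetCard]; exact Nat.choose_pos (by omega)
  have hz0 : 0 < z := Finset.sum_pos (fun _ _ => hf _) (Finset.card_pos.1 hm0)
  have hw0 : 0 < w := Finset.sum_pos (fun _ _ => hf _) (Finset.card_pos.1 hl0)
  have hcard : ((U.powersetCard (n + 1)).card : ℝ) =
      (V.powersetCard (n + 1)).card + (V.powersetCard n).card := by
    simpa using sum_powersetCard_split hk n (fun _ => (1 : ℝ))
  have h2 := two_point_entropy_le hz0 hw0 (Nat.cast_pos (α := ℝ).2 hm0)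
    (Nat.cast_pos (α := ℝ).2 hl0)
  -- The coupling of the two blocks by exchanging `k` for an element outside the set.
  have hQ : (∑ S ∈ U.powersetCard (n + 1), if k ∈ S then ∑ b ∈ U \ S,
        logDiff (f S) (f (insert b (S.erase k))) else 0) =
      ∑ T ∈ V.powersetCard n, ∑ b ∈ V \ T, logDiff (f (insert k T)) (f (insert b T)) := by
    rw [sum_powersetCard_split hk, Finset.sum_eq_zero (s := V.powersetCard (n + 1)), zero_add]
    · refine Finset.sum_congr rfl fun S hS => ?_
      have h1 : k ∉ S := fun h => by simpa [hV] using (Finset.mem_powersetCard.1 hS).1 h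
      rw [if_pos (Finset.mem_insert_self k S), Finset.erase_insert h1]
      have e : U \ insert k S = V \ S := by
        ext x; simp only [hV, Finset.mem_sdiff, Finset.mem_insert, Finset.mem_erase]; tauto
      rw [e]
    · intro S hS
      have h1 : k ∉ S := fun h => by simpa [hV] using (Finset.mem_powersetCard.1 hS).1 h
      rw [if_neg h1]
  have hcomp : ∀ T ∈ V.powersetCard n, (V \ T).card = U.card - 1 - n := fun T hT => by
    rw [Finset.card_sdiff_of_subset (Finset.mem_powersetCard.1 hT).1,
      (Finset.mem_powersetCard.1 hT).2, hVc]
  have hQ2 : logDiff ((U.card - 1 - n : ℕ) * w) ((n + 1) * z) ≤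
      ∑ T ∈ V.powersetCard n, ∑ b ∈ V \ T, logDiff (f (insert k T)) (f (insert b T)) := by
    rw [hz, ← sum_powersetCard_insert, hw, Finset.mul_sum]
    rw [Finset.sum_congr rfl (g := fun T => ∑ b ∈ V \ T, f (insert k T)) fun T hT => by
      rw [Finset.sum_const, hcomp T hT, nsmul_eq_mul]]
    simp only [Finset.sum_sigma']
    refine logDiff_sum_le _ ?_ _ _ (fun _ _ => hf _) (fun _ _ => hf _)
    obtain ⟨T, hT⟩ := Finset.card_pos.1 hl0
    obtain ⟨b, hb⟩ := Finset.card_pos.1 (show 0 < (V \ T).card by rw [hcomp T hT]; omega)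
    exact ⟨⟨T, b⟩, Finset.mem_sigma.2 ⟨hT, hb⟩⟩
  have hratio : ((V.powersetCard n).card : ℝ) * (U.card - 1 - n : ℕ) =
      (n + 1) * (V.powersetCard (n + 1)).card := by
    have := sum_powersetCard_insert V n (fun _ => (1 : ℝ))
    rw [Finset.sum_congr rfl (g := fun T => ((U.card - 1 - n : ℕ) : ℝ)) fun T hT => by
      rw [Finset.sum_const, hcomp T hT, nsmul_eq_mul, mul_one]] at this
    simpa using this
  rw [hQ]
  set r : ℝ := (V.powersetCard n).card / (n + 1) with hr
  have hr0 : 0 < r := by positivity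
  have hl : ((V.powersetCard n).card : ℝ) = r * (n + 1) := by rw [hr]; field_simp
  have hm : ((V.powersetCard (n + 1)).card : ℝ) = r * (U.card - 1 - n : ℕ) := by
    rw [hr]; field_simp; linarith
  have hNn : (((U.card - 1 - n : ℕ) : ℝ)) = U.card - 1 - n := by
    rw [Nat.cast_sub (by omega), Nat.cast_sub (by omega)]; simp
  have hN0 : 0 < ((U.card - 1 - n : ℕ) : ℝ) := Nat.cast_pos.2 (by omega)
  have hUpos : (0 : ℝ) < U.card := Nat.cast_pos.2 (by omega)
  have h3 : logDiff ((V.powersetCard (n + 1)).card * w) ((V.powersetCard n).card * z) /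
      ((V.powersetCard (n + 1)).card + (V.powersetCard n).card) =
      logDiff ((U.card - 1 - n : ℕ) * w) ((n + 1) * z) / U.card := by
    have : r * ((U.card - 1 - n : ℕ) : ℝ) + r * (n + 1) = r * U.card := by rw [hNn]; ring
    rw [hl, hm, this, mul_assoc r, mul_assoc r,
      logDiff_mul hr0 (mul_pos hN0 hw0) (mul_pos (by positivity) hz0),
      mul_div_mul_left _ _ hr0.ne']
  have h4 : logDiff ((U.card - 1 - n : ℕ) * w) ((n + 1) * z) / U.card ≤
      (∑ T ∈ V.powersetCard n, ∑ b ∈ V \ T, logDiff (f (insert k T)) (f (insert b T))) /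
        U.card := div_le_div_of_nonneg_right hQ2 hUpos.le
  unfold sliceEntropy
  rw [sum_powersetCard_split hk n f, sum_powersetCard_split hk n (fun S => f S * Real.log (f S)),
    hcard]
  linarith

/-- The modified logarithmic Sobolev inequality for the exchange dynamics on a slice. -/
theorem card_mul_sliceEntropy_le (N : ℕ) : ∀ (U : Finset α), U.card = N → ∀ n ≤ N,
    ∀ f : Finset α → ℝ, (∀ S, 0 < f S) →
    N * sliceEntropy U n f ≤ exchangeSum U n (fun S T => logDiff (f S) (f T)) := by
  induction N with
  | zero =>
    intro U hU n hn f hf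
    simpa using exchangeSum_nonneg fun S T => logDiff_nonneg (hf S) (hf T)
  | succ N ih =>
    intro U hU n hn f hf
    have hQ : 0 ≤ exchangeSum U n (fun S T => logDiff (f S) (f T)) :=
      exchangeSum_nonneg fun S T => logDiff_nonneg (hf S) (hf T)
    rcases n with _ | n
    · rw [sliceEntropy_eq_zero ⟨∅, Finset.powersetCard_zero U⟩, mul_zero]
      exact hQ
    rcases hn.eq_or_lt with h | h
    · rw [sliceEntropy_eq_zero ⟨U, by rw [h, ← hU, Finset.powersetCard_self]⟩, mul_zero]
      exact hQ
    have hN : (0 : ℝ) < N := Nat.cast_pos.2 (by omega)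
    have hstep : ∀ k ∈ U, N * sliceEntropy U (n + 1) f ≤
        (exchangeSum (U.erase k) (n + 1) (fun S T => logDiff (f S) (f T)) +
          exchangeSum (U.erase k) n (fun S T => logDiff (f (insert k S)) (f (insert k T)))) +
        N * ((∑ S ∈ U.powersetCard (n + 1), if k ∈ S then ∑ b ∈ U \ S,
          logDiff (f S) (f (insert b (S.erase k))) else 0) / U.card) := by
      intro k hk
      have hc : (U.erase k).card = N := by rw [Finset.card_erase_of_mem hk, hU]; rfl
      have h1 := ih _ hc (n + 1) (by omega) f hf
      have h2 := ih _ hc n (by omega) (fun S => f (insert k S)) (fun S => hf _)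
      have h3 := mul_le_mul_of_nonneg_left (sliceEntropy_erase_add_le hk (n := n) (by omega) hf) hN.le
      linarith
    have hsum := Finset.sum_le_sum hstep
    rw [Finset.sum_add_distrib, sum_exchangeSum_erase U n (fun S T => logDiff (f S) (f T)),
      Finset.sum_const, nsmul_eq_mul, ← Finset.mul_sum, ← Finset.sum_div, Finset.sum_comm] at hsum
    have hB : (∑ S ∈ U.powersetCard (n + 1), ∑ k ∈ U, if k ∈ S then ∑ b ∈ U \ S,
        logDiff (f S) (f (insert b (S.erase k))) else 0) =
        exchangeSum U (n + 1) (fun S T => logDiff (f S) (f T)) := by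
      refine Finset.sum_congr rfl fun S hS => ?_
      rw [← Finset.sum_filter, Finset.filter_mem_eq_inter,
        Finset.inter_eq_right.2 (Finset.mem_powersetCard.1 hS).1]
    rw [hB, hU] at hsum
    set Q := exchangeSum U (n + 1) (fun S T => logDiff (f S) (f T))
    push_cast at hsum ⊢
    have h5 : N * (Q / (N + 1)) ≤ Q * (N / (N + 1)) := by apply le_of_eq; ring
    have h6 : ((N : ℝ) + 1 - 2) * Q + N * (Q / (N + 1)) ≤ N * Q := by
      have : N * (Q / (N + 1)) ≤ Q := by
        rw [mul_div_assoc', div_le_iff₀ (by positivity)]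
        nlinarith
      linarith
    have h7 : N * ((N + 1) * sliceEntropy U (n + 1) f) ≤ N * Q := by linarith
    exact le_of_mul_le_mul_left h7 hN

lemma logDiff_exp_le (u v : ℝ) : logDiff (Real.exp u) (Real.exp v) ≤
    Real.exp u * (max (u - v) 0) ^ 2 + Real.exp v * (max (v - u) 0) ^ 2 := by
  have key : ∀ u v : ℝ, v ≤ u → logDiff (Real.exp u) (Real.exp v) ≤
      Real.exp u * (max (u - v) 0) ^ 2 + Real.exp v * (max (v - u) 0) ^ 2 := by
    intro u v h
    rw [max_eq_left (sub_nonneg.2 h), max_eq_right (sub_nonpos.2 h)]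
    unfold logDiff
    rw [Real.log_exp, Real.log_exp]
    have h1 := Real.add_one_le_exp (v - u)
    have h2 : Real.exp v = Real.exp u * Real.exp (v - u) := by rw [← Real.exp_add]; ring_nf
    have h3 : Real.exp u - Real.exp v ≤ Real.exp u * (u - v) := by
      rw [h2]; nlinarith [Real.exp_pos u]
    nlinarith [mul_le_mul_of_nonneg_right h3 (sub_nonneg.2 h)]
  rcases le_total v u with h | h
  · exact key u v h
  · have := key v u h
    unfold logDiff at this ⊢
    linarith

/-- Entropy bound for exponentials with bounded one-sided discrete gradient. -/
lemma sliceEntropy_exp_le {U : Finset α} {n : ℕ} (hn : n ≤ U.card) (hU : 0 < U.card)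
    (F : Finset α → ℝ) {G : ℝ}
    (hF : ∀ S ∈ U.powersetCard n, ∑ a ∈ S, ∑ b ∈ U \ S,
      (max (F S - F (insert b (S.erase a))) 0) ^ 2 ≤ G) {l : ℝ} (hl : 0 ≤ l) :
    sliceEntropy U n (fun S => Real.exp (l * F S)) ≤
      2 * (G / U.card) * l ^ 2 * ∑ S ∈ U.powersetCard n, Real.exp (l * F S) := by
  have hpos : (0 : ℝ) < U.card := Nat.cast_pos.2 hU
  have h1 := card_mul_sliceEntropy_le U.card U rfl n hn (fun S => Real.exp (l * F S))
    (fun S => Real.exp_pos _)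
  set g : Finset α → Finset α → ℝ := fun S T => Real.exp (l * F S) * (l * max (F S - F T) 0) ^ 2
  have hmax : ∀ x y : ℝ, max (l * x - l * y) 0 = l * max (x - y) 0 := fun x y => by
    rw [← mul_sub, mul_max_of_nonneg _ _ hl, mul_zero]
  have h2 : exchangeSum U n (fun S T => logDiff (Real.exp (l * F S)) (Real.exp (l * F T))) ≤
      exchangeSum U n g + exchangeSum U n (fun S T => g T S) := by
    unfold exchangeSum
    simp only [← Finset.sum_add_distrib]
    gcongr with S _ a _ b _
    have := logDiff_exp_le (l * F S) (l * F (insert b (S.erase a)))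
    rwa [hmax, hmax] at this
  rw [exchangeSum_comm U n g] at h2
  have h3 : exchangeSum U n g ≤ ∑ S ∈ U.powersetCard n, G * l ^ 2 * Real.exp (l * F S) := by
    unfold exchangeSum
    refine Finset.sum_le_sum fun S hS => ?_
    have e : ∑ a ∈ S, ∑ b ∈ U \ S, g S (insert b (S.erase a)) = (∑ a ∈ S, ∑ b ∈ U \ S,
      (max (F S - F (insert b (S.erase a))) 0) ^ 2) * (l ^ 2 * Real.exp (l * F S)) := by
      simp only [Finset.sum_mul, g]
      exact Finset.sum_congr rfl fun _ _ => Finset.sum_congr rfl fun _ _ => by ring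
    rw [e, mul_assoc]
    exact mul_le_mul_of_nonneg_right (hF S hS) (by positivity)
  rw [← Finset.mul_sum] at h3
  have h4 : U.card * (2 * (G / U.card) * l ^ 2 * ∑ S ∈ U.powersetCard n, Real.exp (l * F S)) =
      2 * (G * l ^ 2 * ∑ S ∈ U.powersetCard n, Real.exp (l * F S)) := by field_simp
  refine le_of_mul_le_mul_left ?_ hpos
  rw [h4]
  linarith

end SliceEntropy

/-- Herbst's argument in differential form. -/
lemma le_of_mul_deriv_sub_le {ψ ψ' : ℝ → ℝ} {c : ℝ} (h0 : ψ 0 = 0)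
    (hd : ∀ x, HasDerivAt ψ (ψ' x) x) (h : ∀ x, 0 < x → x * ψ' x - ψ x ≤ c * x ^ 2) {x : ℝ}
    (hx : 0 < x) : ψ x ≤ x * ψ' 0 + c * x ^ 2 := by
  have hder : ∀ y ∈ Set.Ioi (0 : ℝ), HasDerivAt (fun y => ψ y / y - c * y)
      ((ψ' y * y - ψ y * 1) / y ^ 2 - c * 1) y := fun y hy =>
    ((hd y).div (hasDerivAt_id y) (ne_of_gt hy)).sub ((hasDerivAt_id y).const_mul c)
  have hanti : AntitoneOn (fun y => ψ y / y - c * y) (Set.Ioi 0) := by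
    refine antitoneOn_of_deriv_nonpos (convex_Ioi 0)
      (fun y hy => (hder y hy).continuousAt.continuousWithinAt)
      (fun y hy => ?_) (fun y hy => ?_)
    · rw [interior_Ioi] at hy
      exact (hder y hy).differentiableAt.differentiableWithinAt
    · rw [interior_Ioi] at hy
      have hy' : 0 < y := hy
      rw [(hder y hy).deriv, sub_nonpos, div_le_iff₀ (by positivity)]
      linarith [h y hy]
  have hlim : Filter.Tendsto (fun y => ψ y / y - c * y) (nhdsWithin 0 (Set.Ioi 0))
      (nhds (ψ' 0 - c * 0)) := by
    refine Filter.Tendsto.sub ?_ ?_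
    · have := (hasDerivAt_iff_tendsto_slope.1 (hd 0)).mono_left
        (nhdsWithin_mono 0 (fun y (hy : 0 < y) => ne_of_gt hy))
      refine this.congr fun y => ?_
      rw [slope_def_field, h0, sub_zero, sub_zero]
    · exact ((continuous_const.mul continuous_id).tendsto 0).mono_left nhdsWithin_le_nhds
  have hle : ψ x / x - c * x ≤ ψ' 0 - c * 0 := by
    refine ge_of_tendsto hlim ?_
    filter_upwards [Ioo_mem_nhdsGT hx] with y hy
    exact hanti hy.1 hx hy.2.le
  have : ψ x / x ≤ ψ' 0 + c * x := by linarith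
  rw [div_le_iff₀ hx] at this
  linarith

section SliceConcentration

variable {α : Type*} [DecidableEq α]

/-- Sub-Gaussian moment generating function bound on a slice. -/
lemma slice_mgf_le {U : Finset α} {n : ℕ} (hn : n ≤ U.card) (hU : 0 < U.card)
    (F : Finset α → ℝ) {G : ℝ}
    (hF : ∀ S ∈ U.powersetCard n, ∑ a ∈ S, ∑ b ∈ U \ S,
      (max (F S - F (insert b (S.erase a))) 0) ^ 2 ≤ G) {l : ℝ} (hl : 0 < l) :
    ∑ S ∈ U.powersetCard n, Real.exp (l * F S) ≤ (U.powersetCard n).card *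
      Real.exp (l * ((∑ S ∈ U.powersetCard n, F S) / (U.powersetCard n).card) +
        2 * (G / U.card) * l ^ 2) := by
  set X := U.powersetCard n with hX
  have hM0 : 0 < X.card := by
    rw [hX, Finset.card_powersetCard]; exact Nat.choose_pos hn
  have hM : (0 : ℝ) < X.card := Nat.cast_pos.2 hM0
  set Z : ℝ → ℝ := fun l => ∑ S ∈ X, Real.exp (l * F S) with hZ
  set Z' : ℝ → ℝ := fun l => ∑ S ∈ X, Real.exp (l * F S) * F S with hZ'
  have hZpos : ∀ l, 0 < Z l := fun l =>
    Finset.sum_pos (fun _ _ => Real.exp_pos _) (Finset.card_pos.1 hM0)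
  have hZd : ∀ l, HasDerivAt Z (Z' l) l := fun l => by
    refine HasDerivAt.fun_sum fun S _ => ?_
    simpa using ((hasDerivAt_id l).mul_const (F S)).exp
  have hψ : ∀ l, HasDerivAt (fun l => Real.log (Z l / X.card)) (Z' l / Z l) l := fun l => by
    have := ((hZd l).div_const (X.card : ℝ)).log (div_pos (hZpos l) hM).ne'
    rwa [div_div_div_cancel_right₀ hM.ne'] at this
  have key := le_of_mul_deriv_sub_le (ψ := fun l => Real.log (Z l / X.card))
    (ψ' := fun l => Z' l / Z l) (c := 2 * (G / U.card)) (by simp [hZ, div_self hM.ne']) hψ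
    (fun x hx => by
      have h := sliceEntropy_exp_le hn hU F hF hx.le
      have e : sliceEntropy U n (fun S => Real.exp (x * F S)) =
          Z x * (x * (Z' x / Z x) - Real.log (Z x / X.card)) := by
        have e1 : ∑ S ∈ X, Real.exp (x * F S) * Real.log (Real.exp (x * F S)) = x * Z' x := by
          simp only [hZ', Finset.mul_sum, Real.log_exp]
          exact Finset.sum_congr rfl fun _ _ => by ring
        unfold sliceEntropy
        rw [← hX, e1]
        have := (hZpos x).ne'
        change x * Z' x - Z x * Real.log (Z x / X.card) = _
        field_simp
      rw [e, ← hX, mul_comm (2 * (G / U.card) * x ^ 2)] at h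
      exact le_of_mul_le_mul_left h (hZpos x)) hl
  have e0 : Z' 0 / Z 0 = (∑ S ∈ X, F S) / X.card := by simp [hZ, hZ']
  simp only [e0] at key
  rw [Real.log_le_iff_le_exp (div_pos (hZpos l) hM), div_le_iff₀ hM] at key
  rw [mul_comm]
  exact key

/-- A nonnegative function vanishing on half of the slice, with bounded one-sided discrete
gradient, has a small mean. -/
lemma slice_mean_sq_le {U : Finset α} {n : ℕ} (hn : n ≤ U.card) (hU : 0 < U.card)
    (F : Finset α → ℝ) (hF0 : ∀ S, 0 ≤ F S) {G : ℝ}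
    (hF : ∀ S ∈ U.powersetCard n, ∑ a ∈ S, ∑ b ∈ U \ S,
      (max (F S - F (insert b (S.erase a))) 0) ^ 2 ≤ G)
    (hhalf : ((U.powersetCard n).card : ℝ) / 2 ≤
      ((U.powersetCard n).filter fun S => F S = 0).card) (hG : 0 ≤ G / U.card) :
    ((∑ S ∈ U.powersetCard n, F S) / (U.powersetCard n).card) ^ 2 ≤ 8 * (G / U.card) := by
  have hmgf := fun l (hl : 0 < l) => slice_mgf_le hn hU F hF (l := l) hl
  set X := U.powersetCard n with hX
  have hM0 : 0 < X.card := by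
    rw [hX, Finset.card_powersetCard]; exact Nat.choose_pos hn
  have hM : (0 : ℝ) < X.card := Nat.cast_pos.2 hM0
  set m := (∑ S ∈ X, F S) / X.card with hm
  set s := G / U.card with hs
  by_contra! hlt
  have hm0 : 0 ≤ m := div_nonneg (Finset.sum_nonneg fun S _ => hF0 S) hM.le
  have hmpos : 0 < m := by
    rcases hm0.eq_or_lt with h | h
    · rw [← h] at hlt; norm_num at hlt; linarith
    · exact h
  have h1 := hmgf (1 / m) (by positivity)
  have h2 : 1 / m * m + 2 * s * (1 / m) ^ 2 ≤ 1 + 1 / 4 := by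
    have : 2 * s * (1 / m) ^ 2 ≤ 1 / 4 := by
      rw [div_pow, one_pow, mul_one_div, div_le_iff₀ (by positivity)]; linarith
    rw [one_div_mul_cancel hmpos.ne']; linarith
  have hpt : ∀ S ∈ X, Real.exp 1 ^ 2 * (F S / m - 1) +
      (if F S = 0 then 1 + Real.exp 1 ^ 2 else 0) ≤ Real.exp (1 / m * F S) := by
    intro S _
    split_ifs with h
    · simp [h]
    · have h3 := Real.add_one_le_exp (F S / m - 2)
      have h4 : Real.exp (1 / m * F S) = Real.exp 1 ^ 2 * Real.exp (F S / m - 2) := by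
        rw [← Real.exp_nat_mul, ← Real.exp_add]; congr 1; push_cast; ring
      rw [h4]
      nlinarith [pow_pos (Real.exp_pos 1) 2]
  have h5 := Finset.sum_le_sum hpt
  rw [Finset.sum_add_distrib, ← Finset.mul_sum, Finset.sum_sub_distrib, ← Finset.sum_div,
    ← Finset.sum_filter, Finset.sum_const, Finset.sum_const, nsmul_eq_mul, nsmul_eq_mul] at h5
  have h6 : (∑ S ∈ X, F S) / m = X.card := by
    rw [hm]
    have : (∑ S ∈ X, F S) ≠ 0 := fun h => by rw [hm, h, zero_div] at hmpos; exact hmpos.false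
    field_simp
  rw [h6, mul_one, sub_self, mul_zero, zero_add] at h5
  have h7 : Real.exp (1 / m * m + 2 * s * (1 / m) ^ 2) ≤ Real.exp 1 * (4 / 3) := by
    refine (Real.exp_le_exp.2 h2).trans ?_
    rw [Real.exp_add]
    have h8 := Real.one_sub_le_exp_neg (1 / 4)
    rw [Real.exp_neg] at h8
    have h9 : Real.exp (1 / 4) ≤ 4 / 3 := by
      have := inv_anti₀ (by norm_num) h8
      rw [inv_inv] at this
      norm_num at this ⊢
      exact this
    exact mul_le_mul_of_nonneg_left h9 (Real.exp_pos 1).le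
  have he1 := Real.exp_one_gt_d9
  have he2 := Real.exp_one_lt_d9
  have h8 : (X.card : ℝ) * Real.exp (1 / m * m + 2 * s * (1 / m) ^ 2) ≤
      X.card * (Real.exp 1 * (4 / 3)) := mul_le_mul_of_nonneg_left h7 hM.le
  have h9 : (X.card : ℝ) / 2 * (1 + Real.exp 1 ^ 2) ≤
    (X.filter fun S => F S = 0).card * (1 + Real.exp 1 ^ 2) :=
      mul_le_mul_of_nonneg_right hhalf (by positivity)
  have h10 : (X.card : ℝ) * ((1 + Real.exp 1 ^ 2) / 2) ≤ X.card * (Real.exp 1 * (4 / 3)) := by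
    linarith
  have h11 := le_of_mul_le_mul_left h10 hM
  nlinarith

lemma slice_tail_le {U : Finset α} {n : ℕ} (hn : n ≤ U.card) (hU : 0 < U.card)
    (F : Finset α → ℝ) (hF0 : ∀ S, 0 ≤ F S) {G : ℝ}
    (hF : ∀ S ∈ U.powersetCard n, ∑ a ∈ S, ∑ b ∈ U \ S,
      (max (F S - F (insert b (S.erase a))) 0) ^ 2 ≤ G)
    (hhalf : ((U.powersetCard n).card : ℝ) / 2 ≤
      ((U.powersetCard n).filter fun S => F S = 0).card) (hG : 0 < G / U.card)
    {t : ℝ} (ht : 0 ≤ t) :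
    (((U.powersetCard n).filter fun S => F S ≥ t).card : ℝ) ≤ (U.powersetCard n).card *
      (Real.exp 1 * Real.exp (-(t ^ 2) / (16 * (G / U.card)))) := by
  have hmgf := fun l (hl : 0 < l) => slice_mgf_le hn hU F hF (l := l) hl
  have hmean := slice_mean_sq_le hn hU F hF0 hF hhalf hG.le
  set X := U.powersetCard n with hX
  set m := (∑ S ∈ X, F S) / X.card with hm
  set s := G / U.card with hs
  rw [← Real.exp_add]
  rcases le_or_gt t m with h | h
  · have h1 : 0 ≤ 1 + -(t ^ 2) / (16 * s) := by
      rw [neg_div, ← sub_eq_add_neg, sub_nonneg, div_le_one (by positivity)]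
      nlinarith
    calc ((X.filter fun S => F S ≥ t).card : ℝ) ≤ X.card := by
          exact_mod_cast Finset.card_filter_le _ _
      _ ≤ _ := le_mul_of_one_le_right (Nat.cast_nonneg _) (Real.one_le_exp h1)
  · set l := (t - m) / (4 * s) with hl
    have hlpos : 0 < l := div_pos (sub_pos.2 h) (by positivity)
    have h1 : (X.filter fun S => F S ≥ t).card * Real.exp (l * t) ≤
        ∑ S ∈ X, Real.exp (l * F S) := by
      rw [← nsmul_eq_mul, ← Finset.sum_const]
      refine (Finset.sum_le_sum fun S hS => ?_).trans
        (Finset.sum_le_sum_of_subset_of_nonneg (Finset.filter_subset _ _)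
          fun _ _ _ => (Real.exp_pos _).le)
      exact Real.exp_le_exp.2
        (mul_le_mul_of_nonneg_left (Finset.mem_filter.1 hS).2 hlpos.le)
    have h2 := h1.trans (hmgf l hlpos)
    rw [← le_div_iff₀ (Real.exp_pos _), mul_div_assoc, ← Real.exp_sub] at h2
    refine h2.trans (mul_le_mul_of_nonneg_left (Real.exp_le_exp.2 ?_) (Nat.cast_nonneg _))
    have e : l * m + 2 * s * l ^ 2 - l * t = -((t - m) ^ 2 / (8 * s)) := by
      rw [hl]; field_simp; ring
    have e2 : 1 + -(t ^ 2) / (16 * s) = (16 * s - t ^ 2) / (16 * s) := by field_simp; ring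
    have e3 : -((t - m) ^ 2 / (8 * s)) = (-(2 * (t - m) ^ 2)) / (16 * s) := by field_simp; norm_num
    rw [e, e2, e3]
    refine div_le_div_of_nonneg_right ?_ (by positivity)
    nlinarith [sq_nonneg (t - 2 * m)]

end SliceConcentration

section ConvexDistance

variable {m : ℕ}

/-- The `α`-weighted Hamming distance from `ω` to `A`. -/
def weightedDist (α ω : Fin m → ℝ) (A : Set (Fin m → ℝ)) : ℝ :=
  sInf { s : ℝ | ∃ ω' ∈ A, s = ∑ i, |α i| * (if ω i = ω' i then (0 : ℝ) else 1) }

lemma convexDist_eq (ω : Fin m → ℝ) (A : Set (Fin m → ℝ)) :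
    convexDist ω A = sSup { r : ℝ | ∃ α : Fin m → ℝ, (∑ i, α i ^ 2) = 1 ∧
      r = weightedDist α ω A } := rfl

lemma weightedHamming_nonneg (α ω ω' : Fin m → ℝ) :
    0 ≤ ∑ i, |α i| * (if ω i = ω' i then (0 : ℝ) else 1) :=
  Finset.sum_nonneg fun i _ => mul_nonneg (abs_nonneg _) (by split_ifs <;> norm_num)

lemma weightedDist_nonneg (α ω : Fin m → ℝ) (A : Set (Fin m → ℝ)) : 0 ≤ weightedDist α ω A := by
  refine Real.sInf_nonneg ?_
  rintro s ⟨ω', -, rfl⟩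
  exact weightedHamming_nonneg α ω ω'

lemma weightedDist_le {A : Set (Fin m → ℝ)} {ω' : Fin m → ℝ} (h : ω' ∈ A) (α ω : Fin m → ℝ) :
    weightedDist α ω A ≤ ∑ i, |α i| * (if ω i = ω' i then (0 : ℝ) else 1) := by
  refine csInf_le ⟨0, ?_⟩ ⟨ω', h, rfl⟩
  rintro s ⟨ω', -, rfl⟩
  exact weightedHamming_nonneg α ω ω'

lemma le_weightedDist {A : Set (Fin m → ℝ)} (hA : A.Nonempty) {α ω : Fin m → ℝ} {r : ℝ}
    (h : ∀ ω' ∈ A, r ≤ ∑ i, |α i| * (if ω i = ω' i then (0 : ℝ) else 1)) :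
    r ≤ weightedDist α ω A := by
  obtain ⟨ω₀, h₀⟩ := hA
  refine le_csInf ⟨_, ω₀, h₀, rfl⟩ ?_
  rintro s ⟨ω', hω', rfl⟩
  exact h ω' hω'

lemma convexDist_nonneg (ω : Fin m → ℝ) (A : Set (Fin m → ℝ)) : 0 ≤ convexDist ω A := by
  refine Real.sSup_nonneg ?_
  rintro r ⟨α, -, rfl⟩
  exact weightedDist_nonneg α ω A

lemma convexDist_eq_zero {ω : Fin m → ℝ} {A : Set (Fin m → ℝ)} (h : ω ∈ A) :
    convexDist ω A = 0 := by
  refine le_antisymm (Real.sSup_nonpos ?_) (convexDist_nonneg ω A)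
  rintro r ⟨α, -, rfl⟩
  exact (weightedDist_le h α ω).trans (by simp)

lemma weightedDist_le_convexDist {A : Set (Fin m → ℝ)} (hA : A.Nonempty) {α : Fin m → ℝ}
    (hα : ∑ i, α i ^ 2 = 1) (ω : Fin m → ℝ) : weightedDist α ω A ≤ convexDist ω A := by
  obtain ⟨ω₀, h₀⟩ := hA
  refine le_csSup ⟨m, ?_⟩ ⟨α, hα, rfl⟩
  rintro r ⟨β, hβ, rfl⟩
  refine (weightedDist_le h₀ β ω).trans ?_
  calc ∑ i, |β i| * (if ω i = ω₀ i then (0 : ℝ) else 1) ≤ ∑ _i : Fin m, (1 : ℝ) := by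
        refine Finset.sum_le_sum fun i _ => ?_
        have h1 : |β i| ≤ 1 := by
          rw [← sq_le_one_iff_abs_le_one, ← hβ]
          exact Finset.single_le_sum (f := fun i => β i ^ 2) (fun _ _ => sq_nonneg _)
            (Finset.mem_univ i)
        split_ifs <;> simp [h1]
    _ = m := by simp

lemma weightedDist_comp {A : Set (Fin m → ℝ)}
    (hA : ∀ ω ∈ A, ∀ σ : Equiv.Perm (Fin m), ω ∘ σ ∈ A) (α ω : Fin m → ℝ)
    (σ : Equiv.Perm (Fin m)) : weightedDist (α ∘ σ) (ω ∘ σ) A = weightedDist α ω A := by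
  unfold weightedDist
  congr 1
  ext s
  constructor
  · rintro ⟨ω', hω', rfl⟩
    refine ⟨ω' ∘ σ.symm, hA ω' hω' σ.symm, ?_⟩
    simpa using Equiv.sum_comp σ
      (fun i => |α i| * (if ω i = ω' (σ.symm i) then (0 : ℝ) else 1))
  · rintro ⟨ω', hω', rfl⟩
    refine ⟨ω' ∘ σ, hA ω' hω' σ, ?_⟩
    rw [← Equiv.sum_comp σ]
    simp

lemma convexDist_comp {A : Set (Fin m → ℝ)}
    (hA : ∀ ω ∈ A, ∀ σ : Equiv.Perm (Fin m), ω ∘ σ ∈ A) (ω : Fin m → ℝ)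
    (σ : Equiv.Perm (Fin m)) : convexDist (ω ∘ σ) A = convexDist ω A := by
  rw [convexDist_eq, convexDist_eq]
  congr 1
  ext r
  constructor
  · rintro ⟨α, hα, rfl⟩
    refine ⟨α ∘ σ.symm, ?_, ?_⟩
    · rw [← hα, ← Equiv.sum_comp σ]
      simp
    · rw [← weightedDist_comp hA (α ∘ σ.symm) ω σ, Function.comp_assoc]
      simp
  · rintro ⟨α, hα, rfl⟩
    exact ⟨α ∘ σ, (Equiv.sum_comp σ (fun i => α i ^ 2)).trans hα,
      (weightedDist_comp hA α ω σ).symm⟩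

lemma continuous_weightedDist {A : Set (Fin m → ℝ)} (hA : A.Nonempty) (ω : Fin m → ℝ) :
    Continuous fun α => weightedDist α ω A := by
  refine (LipschitzWith.of_le_add_mul m fun α β => ?_).continuous
  rw [← sub_le_iff_le_add]
  refine le_weightedDist hA fun ω' hω' => ?_
  rw [sub_le_iff_le_add]
  refine (weightedDist_le hω' α ω).trans ?_
  have e : ((m : NNReal) : ℝ) * dist α β = ∑ _i : Fin m, dist α β := by simp
  rw [e, ← Finset.sum_add_distrib]
  refine Finset.sum_le_sum fun i _ => ?_
  have h1 : |α i - β i| ≤ dist α β := by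
    rw [← Real.dist_eq]; exact dist_le_pi_dist α β i
  have h2 := abs_sub_abs_le_abs_sub (α i) (β i)
  split_ifs
  · simp
  · linarith

/-- The supremum defining the convex distance is attained. -/
lemma exists_weightedDist_eq_convexDist (hm : 0 < m) {A : Set (Fin m → ℝ)} (hA : A.Nonempty)
    (ω : Fin m → ℝ) : ∃ α : Fin m → ℝ, ∑ i, α i ^ 2 = 1 ∧ weightedDist α ω A = convexDist ω A := by
  have hclosed : IsClosed {α : Fin m → ℝ | ∑ i, α i ^ 2 = 1} :=
    isClosed_eq (by fun_prop) continuous_const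
  have hbdd : Bornology.IsBounded {α : Fin m → ℝ | ∑ i, α i ^ 2 = 1} := by
    refine (Metric.isBounded_closedBall (x := (0 : Fin m → ℝ)) (r := 1)).subset fun α hα => ?_
    rw [mem_closedBall_zero_iff, pi_norm_le_iff_of_nonneg zero_le_one]
    intro i
    rw [Real.norm_eq_abs, ← sq_le_one_iff_abs_le_one, ← (show ∑ i, α i ^ 2 = 1 from hα)]
    exact Finset.single_le_sum (f := fun i => α i ^ 2) (fun _ _ => sq_nonneg _)
      (Finset.mem_univ i)
  have hne : {α : Fin m → ℝ | ∑ i, α i ^ 2 = 1}.Nonempty :=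
    ⟨Pi.single ⟨0, hm⟩ 1, by simp [Pi.single_apply]⟩
  obtain ⟨α, hα, hmax⟩ := (Metric.isCompact_of_isClosed_isBounded hclosed hbdd).exists_isMaxOn hne
    (continuous_weightedDist hA ω).continuousOn
  refine ⟨α, hα, le_antisymm (weightedDist_le_convexDist hA hα ω) (csSup_le ⟨_, α, hα, rfl⟩ ?_)⟩
  rintro r ⟨β, hβ, rfl⟩
  exact hmax hβ

/-- Changing the coordinate `i` decreases the convex distance by at most the weight of `i`. -/
lemma exists_convexDist_sub_update_le (hm : 0 < m) {A : Set (Fin m → ℝ)} (hA : A.Nonempty)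
    (ω : Fin m → ℝ) : ∃ α : Fin m → ℝ, ∑ i, α i ^ 2 = 1 ∧
      ∀ i y, convexDist ω A - convexDist (Function.update ω i y) A ≤ |α i| := by
  obtain ⟨α, hα, h⟩ := exists_weightedDist_eq_convexDist hm hA ω
  refine ⟨α, hα, fun i y => ?_⟩
  have h1 := weightedDist_le_convexDist hA hα (Function.update ω i y)
  suffices h2 : weightedDist α ω A - |α i| ≤ weightedDist α (Function.update ω i y) A by linarith
  refine le_weightedDist hA fun ω' hω' => ?_
  rw [sub_le_iff_le_add]
  refine (weightedDist_le hω' α ω).trans ?_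
  rw [← Finset.add_sum_erase _ _ (Finset.mem_univ i), ← Finset.add_sum_erase _ _ (Finset.mem_univ i)]
  have e : ∀ j ∈ Finset.univ.erase i, |α j| * (if ω j = ω' j then (0 : ℝ) else 1) =
      |α j| * (if Function.update ω i y j = ω' j then (0 : ℝ) else 1) := fun j hj => by
    rw [Function.update_of_ne (Finset.ne_of_mem_erase hj)]
  rw [Finset.sum_congr rfl e]
  have h3 : |α i| * (if ω i = ω' i then (0 : ℝ) else 1) ≤ |α i| := by
    split_ifs <;> simp
  have h4 : 0 ≤ |α i| * (if Function.update ω i y i = ω' i then (0 : ℝ) else 1) :=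
    mul_nonneg (abs_nonneg _) (by split_ifs <;> norm_num)
  linarith

end ConvexDistance

section Sampling

variable {N n : ℕ}

lemma exists_perm_of_range_eq {ι β : Type*} {e e' : ι → β} (he : Function.Injective e)
    (he' : Function.Injective e') (h : Set.range e' = Set.range e) :
    ∃ σ : Equiv.Perm ι, e' = e ∘ σ := by
  refine ⟨(Equiv.ofInjective e' he').trans
    ((Equiv.setCongr h).trans (Equiv.ofInjective e he).symm), ?_⟩
  funext i
  simp [Equiv.apply_ofInjective_symm]

/-- The colours `c` of the elements of an `n`-element set, in increasing order of the elements. -/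
def sampleOf (n : ℕ) (c : Fin N → ℝ) (S : Finset (Fin N)) : Fin n → ℝ :=
  if h : S.card = n then c ∘ S.orderEmbOfFin h else 0

lemma sampleOf_invariant {β : Type*} {φ : (Fin n → ℝ) → β}
    (hφ : ∀ ω, ∀ σ : Equiv.Perm (Fin n), φ (ω ∘ σ) = φ ω) (c : Fin N → ℝ) {S : Finset (Fin N)}
    {e : Fin n → Fin N} (he : Function.Injective e) (hS : Set.range e = S) :
    φ (sampleOf n c S) = φ (c ∘ e) := by
  have hc : S.card = n := by
    rw [← Set.ncard_coe_finset, ← hS, ← Set.image_univ, Set.ncard_image_of_injective _ he]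
    simp
  obtain ⟨σ, hσ⟩ := exists_perm_of_range_eq (S.orderEmbOfFin hc).injective he
    (by rw [hS, Finset.range_orderEmbOfFin])
  rw [sampleOf, dif_pos hc, hσ, ← Function.comp_assoc, hφ]

lemma sum_sq_convexDist_exchange_le {A : Set (Fin n → ℝ)} (hA : A.Nonempty)
    (hAsym : ∀ ω ∈ A, ∀ σ : Equiv.Perm (Fin n), ω ∘ σ ∈ A) (c : Fin N → ℝ) (hn : n ≤ N)
    {S : Finset (Fin N)} (hS : S.card = n) :
    ∑ a ∈ S, ∑ b ∈ Finset.univ \ S, (max (convexDist (sampleOf n c S) A -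
      convexDist (sampleOf n c (insert b (S.erase a))) A) 0) ^ 2 ≤ (N : ℝ) - n := by
  rcases Nat.eq_zero_or_pos n with h0 | hpos
  · subst h0
    rw [Finset.card_eq_zero.1 hS]
    simp
  set e := S.orderEmbOfFin hS with he
  have hrange : Set.range e = S := Finset.range_orderEmbOfFin S hS
  have hω : sampleOf n c S = c ∘ e := by rw [sampleOf, dif_pos hS]
  obtain ⟨α, hα, h⟩ := exists_convexDist_sub_update_le hpos hA (c ∘ e)
  have himage : S = Finset.univ.image e := by
    rw [← Finset.coe_inj, ← hrange]; simp
  have hterm : ∀ i, ∀ b ∈ Finset.univ \ S, (max (convexDist (sampleOf n c S) A -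
      convexDist (sampleOf n c (insert b (S.erase (e i)))) A) 0) ^ 2 ≤ α i ^ 2 := by
    intro i b hb
    have hbe : ∀ j, e j ≠ b := fun j hj => (Finset.mem_sdiff.1 hb).2 (by
      rw [← hj, ← Finset.mem_coe, ← hrange]; exact ⟨j, rfl⟩)
    have hinj : Function.Injective (Function.update e i b) := by
      intro j k hjk
      by_cases hj : j = i <;> by_cases hk : k = i
      · rw [hj, hk]
      · rw [hj, Function.update_self, Function.update_of_ne hk] at hjk
        exact absurd hjk.symm (hbe k)
      · rw [hk, Function.update_self, Function.update_of_ne hj] at hjk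
        exact absurd hjk (hbe j)
      · rw [Function.update_of_ne hj, Function.update_of_ne hk] at hjk
        exact e.injective hjk
    have hr : Set.range (Function.update e i b) = (insert b (S.erase (e i)) : Finset (Fin N)) := by
      ext y
      simp only [Set.mem_range, Finset.coe_insert, Finset.coe_erase, ← hrange, Set.mem_insert_iff,
        Set.mem_sdiff, Set.mem_singleton_iff]
      constructor
      · rintro ⟨j, rfl⟩
        by_cases hj : j = i
        · left; rw [hj, Function.update_self]
        · right
          rw [Function.update_of_ne hj]
          exact ⟨⟨j, rfl⟩, fun hji => hj (e.injective hji)⟩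
      · rintro (rfl | ⟨⟨j, rfl⟩, hj⟩)
        · exact ⟨i, Function.update_self ..⟩
        · exact ⟨j, Function.update_of_ne (fun hji => hj (congrArg e hji)) ..⟩
    rw [sampleOf_invariant (φ := fun ω => convexDist ω A) (convexDist_comp hAsym) c hinj hr,
      Function.comp_update, hω, ← sq_abs (α i)]
    exact pow_le_pow_left₀ (le_max_right _ _) (max_le (h i (c b)) (abs_nonneg _)) 2
  nth_rewrite 1 [himage]
  rw [Finset.sum_image e.injective.injOn]
  calc _ ≤ ∑ i : Fin n, ∑ _b ∈ Finset.univ \ S, α i ^ 2 :=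
        Finset.sum_le_sum fun i _ => Finset.sum_le_sum (hterm i)
    _ = (N : ℝ) - n := by
        simp only [Finset.sum_const, nsmul_eq_mul]
        rw [← Finset.mul_sum, hα, mul_one, Finset.card_sdiff_of_subset (Finset.subset_univ _), hS,
          Finset.card_univ, Fintype.card_fin, Nat.cast_sub hn]

/-- Averaging over the group agrees with averaging over an invariant set on which it acts
transitively. -/
lemma card_mul_sum_smul_eq {G β : Type*} [Group G] [Fintype G] [MulAction G β] (X : Finset β)
    (hX : ∀ g : G, ∀ x ∈ X, g • x ∈ X) (htrans : ∀ x ∈ X, ∀ y ∈ X, ∃ g : G, g • x = y)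
    (f : β → ℝ) {x₀ : β} (hx₀ : x₀ ∈ X) :
    X.card * ∑ g : G, f (g • x₀) = Fintype.card G * ∑ x ∈ X, f x := by
  have h1 : ∀ g : G, ∑ x ∈ X, f (g • x) = ∑ x ∈ X, f x := fun g =>
    Finset.sum_nbij' (fun x => g • x) (fun x => g⁻¹ • x) (fun x hx => hX g x hx)
      (fun x hx => hX g⁻¹ x hx) (by simp) (by simp) (by simp)
  have h2 : ∀ x ∈ X, ∑ g : G, f (g • x) = ∑ g : G, f (g • x₀) := by
    intro x hx
    obtain ⟨h, rfl⟩ := htrans x₀ hx₀ x hx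
    rw [← Equiv.sum_comp (Equiv.mulRight h) (fun g => f (g • x₀))]
    simp [mul_smul]
  have h3 : ∑ x ∈ X, ∑ g : G, f (g • x) = X.card * ∑ g : G, f (g • x₀) := by
    rw [Finset.sum_congr rfl h2, Finset.sum_const, nsmul_eq_mul]
  rw [← h3, Finset.sum_comm, Finset.sum_congr rfl (fun g _ => h1 g), Finset.sum_const,
    nsmul_eq_mul, Finset.card_univ]

end Sampling

section Transfer

lemma exists_perm_of_mem_multislice {L N : ℕ} {κ : Fin L → ℕ} {x : Fin L → ℝ}
    {ω ω' : Fin N → ℝ} (h : ω ∈ multislice L N κ x) (h' : ω' ∈ multislice L N κ x) :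
    ∃ g : Equiv.Perm (Fin N), ω ∘ g = ω' := by
  rw [multislice, Finset.mem_filter, Fintype.mem_piFinset] at h h'
  have hfib : ∀ y : ℝ, Nonempty ({i // ω' i = y} ≃ {i // ω i = y}) := by
    intro y
    refine ⟨Fintype.equivOfCardEq ?_⟩
    rw [Fintype.card_subtype, Fintype.card_subtype]
    by_cases hy : ∃ l, x l = y
    · obtain ⟨l, rfl⟩ := hy
      rw [h.2, h'.2]
    · have hempty : ∀ {η : Fin N → ℝ}, (∀ i, η i ∈ Finset.image x Finset.univ) →
          (Finset.univ.filter fun i => η i = y) = ∅ := by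
        intro η hη
        refine Finset.filter_eq_empty_iff.2 fun i _ hi => hy ?_
        obtain ⟨l, -, hl⟩ := Finset.mem_image.1 (hη i)
        exact ⟨l, hl.trans hi⟩
      rw [hempty h.1, hempty h'.1]
  exact ⟨Equiv.ofFiberEquiv fun y => (hfib y).some,
    funext fun i => Equiv.ofFiberEquiv_map _ i⟩

lemma comp_perm_mem_multislice {L N : ℕ} {κ : Fin L → ℕ} {x : Fin L → ℝ} {ω : Fin N → ℝ}
    (h : ω ∈ multislice L N κ x) (g : Equiv.Perm (Fin N)) : ω ∘ g ∈ multislice L N κ x := by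
  rw [multislice, Finset.mem_filter, Fintype.mem_piFinset] at h ⊢
  refine ⟨fun i => h.1 (g i), fun l => ?_⟩
  rw [← h.2 l]
  refine Finset.card_bij (fun i _ => g i) ?_ (fun _ _ _ _ hij => g.injective hij) ?_
  · intro i hi
    simpa using hi
  · intro j hj
    exact ⟨g.symm j, by simpa using hj, by simp⟩

open scoped Pointwise in
lemma exists_perm_smul_eq {α : Type*} [Fintype α] [DecidableEq α] {S T : Finset α}
    (h : S.card = T.card) : ∃ g : Equiv.Perm α, g • S = T := by
  refine ⟨(Finset.equivOfCardEq h).extendSubtype, ?_⟩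
  refine Finset.eq_of_subset_of_card_le (fun y hy => ?_) (by rw [Finset.card_smul_finset, h])
  obtain ⟨i, hi, rfl⟩ := Finset.mem_smul_finset.1 hy
  exact Equiv.extendSubtype_mem _ i hi

open scoped Pointwise in
/-- Averages over the multislice of symmetric functions of the first `n` coordinates are averages
over all `n`-element subsets of the indices. -/
lemma multislice_average_eq {L N n : ℕ} {κ : Fin L → ℕ} {x : Fin L → ℝ} (hn : n ≤ N)
    {c : Fin N → ℝ} (hc : c ∈ multislice L N κ x) {φ : (Fin n → ℝ) → ℝ}
    (hφ : ∀ ω, ∀ σ : Equiv.Perm (Fin n), φ (ω ∘ σ) = φ ω) :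
    (∑ ω ∈ multislice L N κ x, φ (fun i => ω (Fin.castLE hn i))) / (multislice L N κ x).card =
      (∑ S ∈ (Finset.univ : Finset (Fin N)).powersetCard n, φ (sampleOf n c S)) /
        ((Finset.univ : Finset (Fin N)).powersetCard n).card := by
  set X := multislice L N κ x with hX
  set Y := (Finset.univ : Finset (Fin N)).powersetCard n with hY
  set S₀ : Finset (Fin N) := Finset.univ.image (Fin.castLE hn) with hS₀
  have hS₀Y : S₀ ∈ Y := by
    rw [hY, Finset.mem_powersetCard_univ, hS₀,
      Finset.card_image_of_injective _ (Fin.castLE_injective hn), Finset.card_univ,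
      Fintype.card_fin]
  let _ : MulAction (Equiv.Perm (Fin N)) (Fin N → ℝ) := arrowAction
  have h1 := card_mul_sum_smul_eq (G := Equiv.Perm (Fin N)) X
    (fun g ω hω => comp_perm_mem_multislice hω g⁻¹)
    (fun ω hω ω' hω' => by
      obtain ⟨g, hg⟩ := exists_perm_of_mem_multislice hω hω'
      refine ⟨g⁻¹, ?_⟩
      rw [← hg]
      funext i
      change ω (g⁻¹⁻¹ i) = ω (g i)
      rw [inv_inv])
    (fun ω => φ (fun i => ω (Fin.castLE hn i))) hc
  have h2 := card_mul_sum_smul_eq (G := Equiv.Perm (Fin N)) Y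
    (fun g S hS => by
      rw [hY, Finset.mem_powersetCard_univ] at hS ⊢
      rw [Finset.card_smul_finset, hS])
    (fun S hS T hT => exists_perm_smul_eq (by
      rw [hY, Finset.mem_powersetCard_univ] at hS hT
      rw [hS, hT]))
    (fun S => φ (sampleOf n c S)) hS₀Y
  have h3 : ∑ g : Equiv.Perm (Fin N), φ (fun i => (g • c) (Fin.castLE hn i)) =
      ∑ g : Equiv.Perm (Fin N), φ (sampleOf n c (g • S₀)) := by
    rw [← Equiv.sum_comp (Equiv.inv (Equiv.Perm (Fin N)))]
    refine Finset.sum_congr rfl fun g _ => ?_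
    rw [sampleOf_invariant hφ c (e := fun i => g (Fin.castLE hn i))
      (g.injective.comp (Fin.castLE_injective hn))
      (by
        rw [hS₀, Finset.coe_smul_finset, Finset.coe_image, Finset.coe_univ, Set.image_univ]
        ext y
        simp only [Set.mem_smul_set, Set.mem_range, exists_exists_eq_and]
        rfl)]
    congr 1
  have hXpos : (0 : ℝ) < X.card := Nat.cast_pos.2 (Finset.card_pos.2 ⟨c, hc⟩)
  have hYpos : (0 : ℝ) < Y.card := Nat.cast_pos.2 (Finset.card_pos.2 ⟨S₀, hS₀Y⟩)
  have hG : (0 : ℝ) < Fintype.card (Equiv.Perm (Fin N)) := Nat.cast_pos.2 Fintype.card_pos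
  rw [h3] at h1
  rw [div_eq_div_iff hXpos.ne' hYpos.ne']
  refine mul_left_cancel₀ hG.ne' ?_
  rw [← mul_assoc, ← mul_assoc, ← h1, ← h2]
  ring

lemma msProbN_eq_slice {L N n : ℕ} {κ : Fin L → ℕ} {x : Fin L → ℝ} (hn : n ≤ N)
    {c : Fin N → ℝ} (hc : c ∈ multislice L N κ x) (p : (Fin n → ℝ) → Prop)
    (hp : ∀ ω, ∀ σ : Equiv.Perm (Fin n), p (ω ∘ σ) = p ω) :
    msProbN L N n κ x hn p =
      (((Finset.univ : Finset (Fin N)).powersetCard n).filter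
        fun S => p (sampleOf n c S)).card /
        ((Finset.univ : Finset (Fin N)).powersetCard n).card := by
  have h := multislice_average_eq hn hc (φ := fun ω => if p ω then 1 else 0)
    (fun ω σ => by simp only [hp])
  rw [Finset.sum_boole, Finset.sum_boole] at h
  exact h

end Transfer

/-- Convex distance inequality for symmetric sets in `n` out of `N` sampling without
replacement, with the finite-sampling correction factor `1 - n/N`. -/
theorem stmt11 (L N n : ℕ) (hL : 2 ≤ L) (κ : Fin L → ℕ) (hκ : ∀ ℓ, 1 ≤ κ ℓ)
    (hN : N = ∑ ℓ, κ ℓ) (x : Fin L → ℝ) (hx : StrictMono x) (hn : n ≤ N)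
    (A : Set (Fin n → ℝ)) (hA : A ⊆ ↑(msProj L N n κ x hn))
    (hAsym : ∀ ω ∈ A, ∀ σ : Equiv.Perm (Fin n), ω ∘ σ ∈ A)
    (hA2 : msProbN L N n κ x hn (fun ω => ω ∈ A) ≥ 1 / 2)
    (t : ℝ) (ht : 0 ≤ t) :
    msProbN L N n κ x hn (fun ω => convexDist ω A ≥ t) ≤
      Real.exp 1 * Real.exp (-(t ^ 2) / (16 * (1 - (n : ℝ) / N))) := by
  have hL0 : 0 < L := by omega
  have hN0 : 0 < N := by
    rw [hN]
    exact Finset.sum_pos (fun ℓ _ => hκ ℓ) ⟨⟨0, hL0⟩, Finset.mem_univ _⟩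
  have hN1 : (0 : ℝ) < N := Nat.cast_pos.2 hN0
  obtain ⟨c, hc⟩ : (multislice L N κ x).Nonempty := by
    by_contra h
    rw [Finset.not_nonempty_iff_eq_empty] at h
    rw [msProbN, uprob, h] at hA2
    norm_num at hA2
  rcases hn.eq_or_lt with hnN | hlt
  · have h0 : 1 - (n : ℝ) / N = 0 := by rw [hnN, div_self hN1.ne', sub_self]
    rw [h0, mul_zero, div_zero, Real.exp_zero, mul_one]
    refine le_trans ?_ (Real.one_le_exp zero_le_one)
    exact div_le_one_of_le₀ (Nat.cast_le.2 (Finset.card_filter_le _ _)) (Nat.cast_nonneg _)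
  have hcomp : ∀ ω, ∀ σ : Equiv.Perm (Fin n), convexDist (ω ∘ σ) A = convexDist ω A :=
    convexDist_comp hAsym
  have hAinv : ∀ ω, ∀ σ : Equiv.Perm (Fin n), (ω ∘ σ ∈ A) = (ω ∈ A) := fun ω σ => by
    refine propext ⟨fun h => ?_, fun h => hAsym ω h σ⟩
    simpa [Function.comp_assoc] using hAsym _ h σ.symm
  rw [msProbN_eq_slice hn hc (fun ω => ω ∈ A) hAinv] at hA2
  rw [msProbN_eq_slice hn hc (fun ω => convexDist ω A ≥ t) (fun ω σ => by rw [hcomp])]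
  have hU : (Finset.univ : Finset (Fin N)).card = N := by simp
  have hYpos : (0 : ℝ) < ((Finset.univ : Finset (Fin N)).powersetCard n).card := by
    rw [Finset.card_powersetCard, hU]
    exact Nat.cast_pos.2 (Nat.choose_pos hn)
  rw [ge_iff_le, le_div_iff₀ hYpos] at hA2
  have hAne : A.Nonempty := by
    by_contra h
    rw [Set.not_nonempty_iff_eq_empty] at h
    simp only [h, Set.mem_empty_iff_false, Finset.filter_false, Finset.card_empty,
      Nat.cast_zero] at hA2
    linarith
  have hGeq : ((N : ℝ) - n) / (Finset.univ : Finset (Fin N)).card = 1 - (n : ℝ) / N := by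
    rw [hU]; field_simp
  have hGpos : 0 < 1 - (n : ℝ) / N := by
    rw [sub_pos, div_lt_one hN1]; exact Nat.cast_lt.2 hlt
  have hhalf : (((Finset.univ : Finset (Fin N)).powersetCard n).card : ℝ) / 2 ≤
      ((Finset.univ.powersetCard n).filter
        fun S => convexDist (sampleOf n c S) A = 0).card := by
    refine le_trans (by linarith) (hA2.trans (Nat.cast_le.2 (Finset.card_le_card ?_)))
    exact Finset.monotone_filter_right _ fun S _ hS => convexDist_eq_zero hS
  have key := slice_tail_le (U := (Finset.univ : Finset (Fin N))) (n := n) (by rw [hU]; exact hn)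
    (by rw [hU]; exact hN0) (fun S => convexDist (sampleOf n c S) A)
    (fun S => convexDist_nonneg _ _) (G := (N : ℝ) - n)
    (fun S hS => sum_sq_convexDist_exchange_le hAne hAsym c hn (Finset.mem_powersetCard.1 hS).2)
    hhalf (by rw [hGeq]; exact hGpos) ht
  rw [hGeq] at key
  rw [div_le_iff₀ hYpos, mul_comm]
  exact key
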